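/- Let J ⊆ S, d = (d_σ)_{σ∈S∖J} nonnegative integers, and χ1, χ2 : F^× → E^× locally J-analytic characters. Suppose v_p(χ2(p)) + |d| < 0. Then for every λ ∈ E, every integer n ≥ 0, every multi-index k = (k_σ)_{σ∈S∖J} with 0 ≤ k_σ ≤ d_σ and every m = (m_σ)_{σ∈J} ∈ ℤ≥0^J, the function λ · 1_{D(0,n)}(z) z^k z^m belongs to Λ. (Consequently the gauge seminorm of Λ vanishes on these generators, and the completion of V(χ,J,d) with respect to Λ is zero.) -/

import Mathlib

/- Preamble: formalization of the basic objects from "Fonctions de classe C^r sur O_F"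
   (C^r functions on O_F, locally analytic functions, locally J-analytic characters,
   the spaces V(χ,J,d), B(χ,J,d), the lattice Λ, etc.).

   Conventions:
   * F, E are nonarchimedean complete normed fields (abstracting finite extensions of ℚ_p);
   * O_F is encoded by the predicate ‖·‖ ≤ 1, and functions on O_F are encoded as
     functions on F whose defining conditions only quantify over the unit ball;
   * `q` is the residue cardinality, `ϖ` a uniformizer with ‖ϖ‖ = q⁻¹,
     and D(a,n) = {z : ‖z - a‖ ≤ q^(-n)};
   * S is the (finite) set of embeddings F → E, `emb σ` the corresponding ring maps;
   * multi-indices are functions `i : S → ℕ`; a pair (k over S∖J, m over J) is encoded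
     as the single multi-index agreeing with k off J and with m on J. -/

open scoped Classical Topology
open Filter

noncomputable section

namespace Paper

variable {F E : Type*} [NormedField F] [NormedField E]
variable {S : Type*} [Fintype S]

/-- total degree |i| of a multi-index -/
def mSum (i : S → ℕ) : ℕ := ∑ σ, i σ

/-- i! -/
def mFact (i : S → ℕ) : ℕ := ∏ σ, (i σ).factorial

/-- z^i = ∏_σ σ(z)^(i_σ) -/
def mPow (emb : S → (F →+* E)) (z : F) (i : S → ℕ) : E := ∏ σ, (emb σ z) ^ (i σ)

/-- the (finite) set of multi-indices of total degree ≤ N -/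
def degLE (S : Type*) [Fintype S] (N : ℕ) : Finset (S → ℕ) :=
  ((Finset.univ : Finset (S → Fin (N + 1))).image (fun i σ => (i σ : ℕ))).filter
    (fun i => mSum i ≤ N)

/-- the remainder ε_{f,N}(x,y) = f(x+y) - Σ_{|i| ≤ N} D_i f(x) y^i / i! -/
def crRem (emb : S → (F →+* E)) (N : ℕ) (f : F → E) (Df : (S → ℕ) → F → E)
    (x y : F) : E :=
  f (x + y) - ∑ i ∈ degLE S N, Df i x * mPow emb y i / (mFact i : E)

/-- `f` is of class C^r on O_F with derivative data `Df`: the `Df i` (|i| ≤ ⌊r⌋) are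
bounded on O_F and C_{f,r}(h) = sup_{x ∈ O_F, y ∈ ϖ^h O_F} |ε_{f,[r]}(x,y)| q^{rh} → 0. -/
def IsCrWith (q : ℕ) (emb : S → (F →+* E)) (r : ℝ) (f : F → E)
    (Df : (S → ℕ) → F → E) : Prop :=
  (∀ i : S → ℕ, mSum i ≤ ⌊r⌋₊ → ∃ C : ℝ, ∀ x : F, ‖x‖ ≤ 1 → ‖Df i x‖ ≤ C) ∧
  ∀ ε : ℝ, 0 < ε → ∃ H : ℕ, ∀ h : ℕ, H ≤ h → ∀ x y : F, ‖x‖ ≤ 1 →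
    ‖y‖ ≤ (q : ℝ) ^ (-(h : ℤ)) →
      ‖crRem emb ⌊r⌋₊ f Df x y‖ * (q : ℝ) ^ (r * (h : ℝ)) ≤ ε

/-- `f` is of class C^r on O_F -/
def IsCr (q : ℕ) (emb : S → (F →+* E)) (r : ℝ) (f : F → E) : Prop :=
  ∃ Df, IsCrWith q emb r f Df

/-- the C^r norm computed from derivative data `Df` -/
def crNormWith (emb : S → (F →+* E)) (r : ℝ) (f : F → E)
    (Df : (S → ℕ) → F → E) : ℝ :=
  sSup ({x | ∃ i : S → ℕ, mSum i ≤ ⌊r⌋₊ ∧ ∃ z : F, ‖z‖ ≤ 1 ∧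
          x = ‖Df i z / (mFact i : E)‖} ∪
        {x | ∃ z y : F, ‖z‖ ≤ 1 ∧ ‖y‖ ≤ 1 ∧ y ≠ 0 ∧
          x = ‖crRem emb ⌊r⌋₊ f Df z y‖ / ‖y‖ ^ r})

/-- the C^r norm of `f` (the derivative data being unique, the set below is a singleton
when `f` is of class C^r). -/
def crNorm (q : ℕ) (emb : S → (F →+* E)) (r : ℝ) (f : F → E) : ℝ :=
  sSup {c | ∃ Df, IsCrWith q emb r f Df ∧ c = crNormWith emb r f Df}

/-- membership in the closed subspace C^r(O_F, J, d) of C^r(O_F, E):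
∂^{dσ+1} f / ∂z_σ^{dσ+1} = 0 for σ ∉ J. -/
def IsCrJ (q : ℕ) (emb : S → (F →+* E)) (r : ℝ) (J : Set S) (d : S → ℕ)
    (f : F → E) : Prop :=
  ∃ Df, IsCrWith q emb r f Df ∧
    ∀ σ : S, σ ∉ J → ∀ x : F, ‖x‖ ≤ 1 → Df (Pi.single σ (d σ + 1)) x = 0

/-- `c` is the family of Taylor coefficients of an expansion of `f` on D(a,h), with
exponents bounded by `d` off `J`, and coefficients with ‖c m‖ q^{-h|m|} → 0. -/
def IsExpansionAt (q : ℕ) (emb : S → (F →+* E)) (J : Set S) (d : S → ℕ) (h : ℕ)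
    (a : F) (c : (S → ℕ) → E) (f : F → E) : Prop :=
  (∀ m : S → ℕ, ¬ (∀ σ, σ ∉ J → m σ ≤ d σ) → c m = 0) ∧
  Tendsto (fun m : S → ℕ => ‖c m‖ * (q : ℝ) ^ (-(h : ℝ) * (mSum m : ℝ)))
    cofinite (nhds 0) ∧
  ∀ z : F, ‖z - a‖ ≤ (q : ℝ) ^ (-(h : ℤ)) →
    HasSum (fun m : S → ℕ => c m * mPow emb (z - a) m) (f z)

/-- membership in F_h(O_F, J, d) -/
def IsFh (q : ℕ) (emb : S → (F →+* E)) (J : Set S) (d : S → ℕ) (h : ℕ)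
    (f : F → E) : Prop :=
  ∀ a : F, ‖a‖ ≤ 1 → ∃ c : (S → ℕ) → E, IsExpansionAt q emb J d h a c f

/-- membership in F(O_F, J, d) = ∪_h F_h(O_F, J, d) -/
def IsF (q : ℕ) (emb : S → (F →+* E)) (J : Set S) (d : S → ℕ) (f : F → E) : Prop :=
  ∃ h : ℕ, IsFh q emb J d h f

/-- the norm of F_h(O_F, J, d) -/
def FhNorm (q : ℕ) (emb : S → (F →+* E)) (J : Set S) (d : S → ℕ) (h : ℕ)
    (f : F → E) : ℝ :=
  sSup {x | ∃ a : F, ‖a‖ ≤ 1 ∧ ∃ c : (S → ℕ) → E, IsExpansionAt q emb J d h a c f ∧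
        ∃ m : S → ℕ, x = ‖c m‖ * (q : ℝ) ^ (-(h : ℝ) * (mSum m : ℝ))}

/-- membership in F^N(O_F, J, d): member of F(O_F,J,d) which is a sum of members of the
spaces F(O_F, ∅, d'') over multi-indices d'' of total degree ≤ N. -/
def IsFN (q : ℕ) (emb : S → (F →+* E)) (J : Set S) (d : S → ℕ) (N : ℕ)
    (f : F → E) : Prop :=
  IsF q emb J d f ∧ ∃ g : (S → ℕ) → (F → E),
    (∀ m ∈ degLE S N, IsF q emb (∅ : Set S) m (g m)) ∧
    ∀ z : F, ‖z‖ ≤ 1 → f z = ∑ m ∈ degLE S N, g m z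

/-- |d| = Σ_{σ ∉ J} d_σ -/
def dSum (J : Set S) (d : S → ℕ) : ℕ :=
  ∑ σ ∈ Finset.univ.filter (fun σ => σ ∉ J), d σ

/-- z^d = ∏_{σ ∉ J} σ(z)^{d_σ} -/
def dPow (emb : S → (F →+* E)) (J : Set S) (d : S → ℕ) (z : F) : E :=
  ∏ σ ∈ Finset.univ.filter (fun σ => σ ∉ J), (emb σ z) ^ (d σ)

/-- z^{d-k} z^{-m} where (k, m) is encoded by the single multi-index `i`
(k = i off J, m = i on J). -/
def negPow (emb : S → (F →+* E)) (J : Set S) (d : S → ℕ) (i : S → ℕ) (z : F) : E :=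
  (∏ σ ∈ Finset.univ.filter (fun σ => σ ∉ J), (emb σ z) ^ (d σ - i σ)) /
    (∏ σ ∈ Finset.univ.filter (fun σ => σ ∈ J), (emb σ z) ^ (i σ))

/-- the function 1_{D(a,n)}(z) (z-a)^i -/
def test1 (q : ℕ) (emb : S → (F →+* E)) (a : F) (n : ℤ) (i : S → ℕ) : F → E :=
  fun z => if ‖z - a‖ ≤ (q : ℝ) ^ (-n) then mPow emb (z - a) i else 0

/-- the function χ2 χ1⁻¹ -/
def chRatio (χ1 χ2 : F →* E) (z : F) : E := χ2 z / χ1 z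

/-- the function 1_{F∖D(a,n+1)}(z) χ2χ1⁻¹(z-a) (z-a)^{d-k} (z-a)^{-m} -/
def test2 (q : ℕ) (emb : S → (F →+* E)) (J : Set S) (d : S → ℕ) (χ1 χ2 : F →* E)
    (a : F) (n : ℤ) (i : S → ℕ) : F → E :=
  fun z => if ‖z - a‖ ≤ (q : ℝ) ^ (-(n + 1)) then 0
    else chRatio χ1 χ2 (z - a) * negPow emb J d i (z - a)

/-- the ϖ-adic valuation v(a) (so that ‖a‖ = q^{-v(a)} for a ≠ 0) -/
def valF (q : ℕ) (a : F) : ℤ := ⌊-(Real.logb q ‖a‖)⌋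

/-- the function 1_{D(1/a, n - 2v(a))}(z) χ2χ1⁻¹(z) z^d (1/z - a)^k (1/z - a)^m -/
def test3 (q : ℕ) (emb : S → (F →+* E)) (J : Set S) (d : S → ℕ) (χ1 χ2 : F →* E)
    (a : F) (n : ℤ) (i : S → ℕ) : F → E :=
  fun z => if ‖z - a⁻¹‖ ≤ (q : ℝ) ^ (-(n - 2 * valF q a))
    then chRatio χ1 χ2 z * dPow emb J d z * mPow emb (z⁻¹ - a) i else 0

/-- locally J-analytic character: continuous on F^× and, on each disk D(a,l) around a
unit, given by a convergent power series in the variables (σ(z) - σ(a))_{σ ∈ J}. -/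
def IsLocJChar (q : ℕ) (emb : S → (F →+* E)) (J : Set S) (χ : F →* E) : Prop :=
  ContinuousOn (χ : F → E) {z : F | z ≠ 0} ∧
  ∃ l : ℕ, ∀ a : F, ‖a‖ = 1 → ∃ c : (S → ℕ) → E,
    (∀ m : S → ℕ, ¬ (∀ σ, σ ∉ J → m σ = 0) → c m = 0) ∧
    ∀ z : F, ‖z - a‖ ≤ (q : ℝ) ^ (-(l : ℤ)) →
      HasSum (fun m : S → ℕ => c m * mPow emb (z - a) m) (χ z)

/-- the valuation v_p on E normalized by v_p(p) = 1, given that ‖x‖ = p^{-ef·v_p(x)}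
(ef = [F:ℚ_p]). -/
def vP (p : ℕ) (ef : ℕ) (x : E) : ℝ := -(Real.logb p ‖x‖) / (ef : ℝ)

/-- the monomial character z ↦ ∏_{σ ∈ T} σ(z)^{d_σ} -/
def monChar (emb : S → (F →+* E)) (T : Set S) (d : S → ℕ) : F →* E where
  toFun z := ∏ σ ∈ Finset.univ.filter (fun σ => σ ∈ T), (emb σ z) ^ (d σ)
  map_one' := by simp
  map_mul' := by
    intro x y
    simp [map_mul, mul_pow, Finset.prod_mul_distrib]

/-- `g` is (on O_F ∖ {0}) the function z ↦ χ2χ1⁻¹(z) z^d f(1/z); i.e. `g` is an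
extension to O_F of the second-chart transform of `f`. -/
def ExtProp (emb : S → (F →+* E)) (J : Set S) (d : S → ℕ) (χ1 χ2 : F →* E)
    (f g : F → E) : Prop :=
  ∀ z : F, z ≠ 0 → ‖z‖ ≤ 1 → g z = chRatio χ1 χ2 z * dPow emb J d z * f z⁻¹

/-- membership in V(χ, J, d) (global sections of the locally analytic sheaf) -/
def MemV (q : ℕ) (emb : S → (F →+* E)) (J : Set S) (d : S → ℕ) (χ1 χ2 : F →* E)
    (f : F → E) : Prop :=
  IsF q emb J d f ∧ ∃ g : F → E, IsF q emb J d g ∧ ExtProp emb J d χ1 χ2 f g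

/-- membership in the Banach space B(χ, J, d) -/
def MemB (q : ℕ) (emb : S → (F →+* E)) (r : ℝ) (J : Set S) (d : S → ℕ)
    (χ1 χ2 : F →* E) (f : F → E) : Prop :=
  IsCrJ q emb r J d f ∧ ∃ g : F → E, IsCrJ q emb r J d g ∧ ExtProp emb J d χ1 χ2 f g

/-- the norm of B(χ, J, d): ‖f‖_B = max(‖f₁‖_{C^r}, ‖f₂‖_{C^r}) where
f₁(z) = f(ϖ z) and f₂ is the extension of z ↦ χ2χ1⁻¹(z) z^d f(1/z). -/
def BNorm (q : ℕ) (emb : S → (F →+* E)) (r : ℝ) (J : Set S) (d : S → ℕ)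
    (χ1 χ2 : F →* E) (ϖ : F) (f : F → E) : ℝ :=
  sSup {x | ∃ g : F → E, IsCrJ q emb r J d g ∧ ExtProp emb J d χ1 χ2 f g ∧
    x = max (crNorm q emb r (fun z => f (ϖ * z))) (crNorm q emb r g)}

/-- the ring of integers O_E as a subring of E -/
def unitBall (E : Type*) [NormedField E] [IsUltrametricDist E] : Subring E where
  carrier := {x : E | ‖x‖ ≤ 1}
  mul_mem' := by
    intro a b ha hb
    simp only [Set.mem_setOf_eq] at *
    calc ‖a * b‖ = ‖a‖ * ‖b‖ := norm_mul a b
    _ ≤ 1 * 1 := mul_le_mul ha hb (norm_nonneg b) zero_le_one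
    _ = 1 := one_mul 1
  one_mem' := by simp
  add_mem' := by
    intro a b ha hb
    simp only [Set.mem_setOf_eq] at *
    exact le_trans (IsUltrametricDist.norm_add_le_max a b) (max_le ha hb)
  zero_mem' := by simp
  neg_mem' := by
    intro a ha
    simpa using ha

instance (E : Type*) [NormedField E] [IsUltrametricDist E] :
    Algebra (unitBall E) E := (unitBall E).subtype.toAlgebra

/-- the action of the Borel element [[t, u], [0, v]] on functions -/
def borelAct (emb : S → (F →+* E)) (J : Set S) (d : S → ℕ) (χ1 χ2 : F →* E)
    (t u v : F) (f : F → E) : F → E :=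
  fun z => χ1 (t * v) * chRatio χ1 χ2 t * dPow emb J d t * f ((v * z - u) / t)

/-- the generator 1_{O_F}(z) z^k z^m -/
def genPoly (emb : S → (F →+* E)) (i : S → ℕ) : F → E :=
  fun z => if ‖z‖ ≤ 1 then mPow emb z i else 0

/-- the generator 1_{F∖O_F}(z) χ2χ1⁻¹(z) z^{d-k} z^{-m} -/
def genSing (emb : S → (F →+* E)) (J : Set S) (d : S → ℕ) (χ1 χ2 : F →* E)
    (i : S → ℕ) : F → E :=
  fun z => if ‖z‖ ≤ 1 then 0 else chRatio χ1 χ2 z * negPow emb J d i z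

/-- the generating set of Λ: Borel translates of the basic generators -/
def lambdaGens (emb : S → (F →+* E)) (J : Set S) (d : S → ℕ) (χ1 χ2 : F →* E) :
    Set (F → E) :=
  {h | ∃ t u v : F, ∃ i : S → ℕ, t ≠ 0 ∧ v ≠ 0 ∧ (∀ σ, σ ∉ J → i σ ≤ d σ) ∧
    (h = borelAct emb J d χ1 χ2 t u v (genPoly emb i) ∨
     h = borelAct emb J d χ1 χ2 t u v (genSing emb J d χ1 χ2 i))}

/-- the O_E[P]-lattice Λ -/
def Lambda [IsUltrametricDist E] (emb : S → (F →+* E)) (J : Set S) (d : S → ℕ)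
    (χ1 χ2 : F →* E) : Submodule ↥(unitBall E) (F → E) :=
  Submodule.span ↥(unitBall E) (lambdaGens emb J d χ1 χ2)

/-- the gauge (jauge) ‖f‖_Λ = inf{‖λ‖ : λ ∈ E^×, f ∈ λΛ} of a lattice Λ -/
def lamGauge [IsUltrametricDist E] (Λ : Submodule ↥(unitBall E) (F → E))
    (f : F → E) : ℝ :=
  sInf {c : ℝ | ∃ lam : E, lam ≠ 0 ∧ c = ‖lam‖ ∧ ∃ g, g ∈ Λ ∧ f = lam • g}

/-- the formula for the action of g = (a b; c d) ∈ GL₂(F):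
(g·f)(z) = χ1(det g) χ2χ1⁻¹(-cz+a) (-cz+a)^d f((dz-b)/(-cz+a)) -/
def actFormula (emb : S → (F →+* E)) (J : Set S) (d : S → ℕ) (χ1 χ2 : F →* E)
    (g : Matrix (Fin 2) (Fin 2) F) (f : F → E) : F → E :=
  fun z => χ1 (g 0 0 * g 1 1 - g 0 1 * g 1 0) *
    chRatio χ1 χ2 (-(g 1 0) * z + g 0 0) * dPow emb J d (-(g 1 0) * z + g 0 0) *
    f ((g 1 1 * z - g 0 1) / (-(g 1 0) * z + g 0 0))

/-- the action of g ∈ GL₂(F) on functions, extended by continuity (i.e. by taking the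
limit) at the singular point z = a/c when c ≠ 0. -/
def gAct (emb : S → (F →+* E)) (J : Set S) (d : S → ℕ) (χ1 χ2 : F →* E)
    (g : Matrix (Fin 2) (Fin 2) F) (f : F → E) : F → E :=
  fun z => if g 1 0 ≠ 0 ∧ z = g 0 0 / g 1 0 then
      limUnder (𝓝[≠] z) (actFormula emb J d χ1 χ2 g f)
    else actFormula emb J d χ1 χ2 g f z

/-- μ belongs to I(χ,J,d)^∨: both components of μ restrict to continuous linear forms
on each Banach space F_h(O_F,J,d). -/
def MemIdual (q : ℕ) (emb : S → (F →+* E)) (J : Set S) (d : S → ℕ) (χ1 χ2 : F →* E)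
    (ϖ : F) (μ : (F → E) →ₗ[E] E) : Prop :=
  ∀ h : ℕ, ∃ K : ℝ, ∀ f g : F → E,
    IsFh q emb J d h (fun z => f (ϖ * z)) → IsFh q emb J d h g →
    ExtProp emb J d χ1 χ2 f g →
    ‖μ f‖ ≤ K * max (FhNorm q emb J d h (fun z => f (ϖ * z))) (FhNorm q emb J d h g)

/-- ν is a continuous (= bounded) linear form on the Banach space B(χ,J,d) -/
def BBounded (q : ℕ) (emb : S → (F →+* E)) (r : ℝ) (J : Set S) (d : S → ℕ)
    (χ1 χ2 : F →* E) (ϖ : F) (ν : (F → E) →ₗ[E] E) : Prop :=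
  ∃ K : ℝ, ∀ f : F → E, MemB q emb r J d χ1 χ2 f →
    ‖ν f‖ ≤ K * BNorm q emb r J d χ1 χ2 ϖ f

/-- the function z ↦ z^k z^m (a generator of L(χ,J,d)) -/
def lFun1 (emb : S → (F →+* E)) (i : S → ℕ) : F → E := fun z => mPow emb z i

/-- the function z ↦ χ2χ1⁻¹(z-a) (z-a)^{d-k} (z-a)^{-m} (value 0 at z = a),
a generator of L(χ,J,d) -/
def lFun2 (emb : S → (F →+* E)) (J : Set S) (d : S → ℕ) (χ1 χ2 : F →* E)
    (a : F) (i : S → ℕ) : F → E :=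
  fun z => if z = a then 0 else chRatio χ1 χ2 (z - a) * negPow emb J d i (z - a)

/-- the generating set of L(χ,J,d) -/
def lGens (emb : S → (F →+* E)) (J : Set S) (d : S → ℕ) (χ1 χ2 : F →* E)
    (r : ℝ) : Set (F → E) :=
  {h | ∃ i : S → ℕ, (∀ σ, σ ∉ J → i σ ≤ d σ) ∧ (mSum i : ℝ) < r ∧
    (h = lFun1 emb i ∨ ∃ a : F, h = lFun2 emb J d χ1 χ2 a i)}

/-- the distance in B(χ,J,d) from f to the subspace L(χ,J,d), i.e. the quotient
seminorm of B(χ,J,d)/L(χ,J,d) evaluated at the image of f. -/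
def distL (q : ℕ) (emb : S → (F →+* E)) (r : ℝ) (J : Set S) (d : S → ℕ)
    (χ1 χ2 : F →* E) (ϖ : F) (f : F → E) : ℝ :=
  sInf {x | ∃ l ∈ Submodule.span E (lGens emb J d χ1 χ2 r),
    x = BNorm q emb r J d χ1 χ2 ϖ (f - l)}

/-- the GL₂(F)-stable lattice generated by Λ under the group action -/
def LambdaG [IsUltrametricDist E] (emb : S → (F →+* E)) (J : Set S) (d : S → ℕ)
    (χ1 χ2 : F →* E) : Submodule ↥(unitBall E) (F → E) :=
  Submodule.span ↥(unitBall E)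
    {h | ∃ g : Matrix (Fin 2) (Fin 2) F, g 0 0 * g 1 1 - g 0 1 * g 1 0 ≠ 0 ∧
      ∃ x, x ∈ Lambda emb J d χ1 χ2 ∧ h = gAct emb J d χ1 χ2 g x}

/-- C^{r,id} remainder for h : O_F → F -/
def crRemId (N : ℕ) (h : F → F) (Dh : ℕ → F → F) (x y : F) : F :=
  h (x + y) - ∑ i ∈ Finset.range (N + 1), Dh i x * y ^ i / (Nat.factorial i : F)

/-- h : O_F → F is of class C^{r,id} -/
def IsCrId (q : ℕ) (r : ℝ) (h : F → F) : Prop :=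
  ∃ Dh : ℕ → F → F,
    (∀ i : ℕ, i ≤ ⌊r⌋₊ → ∃ C : ℝ, ∀ x : F, ‖x‖ ≤ 1 → ‖Dh i x‖ ≤ C) ∧
    ∀ ε : ℝ, 0 < ε → ∃ K : ℕ, ∀ k : ℕ, K ≤ k → ∀ x y : F, ‖x‖ ≤ 1 →
      ‖y‖ ≤ (q : ℝ) ^ (-(k : ℤ)) → ‖crRemId ⌊r⌋₊ h Dh x y‖ * (q : ℝ) ^ (r * (k : ℝ)) ≤ ε

/-- the set of values defining the dual norm ‖μ‖_{r,d} -/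
def dualSet (q : ℕ) (emb : S → (F →+* E)) (r : ℝ) (J : Set S) (d : S → ℕ)
    (μ : (F → E) →ₗ[E] E) : Set ℝ :=
  {x | ∃ (a : F) (n : ℕ) (i : S → ℕ), ‖a‖ ≤ 1 ∧ (∀ σ, σ ∉ J → i σ ≤ d σ) ∧
    x = ‖μ (test1 q emb a (n : ℤ) i)‖ * (q : ℝ) ^ (-(n : ℝ) * (r - (mSum i : ℝ)))}

/-- the dual norm ‖μ‖_{r,d} -/
def dualNorm (q : ℕ) (emb : S → (F →+* E)) (r : ℝ) (J : Set S) (d : S → ℕ)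
    (μ : (F → E) →ₗ[E] E) : ℝ :=
  sSup (dualSet q emb r J d μ)

/-- the operator norm of μ on C^r(O_F, J, d) -/
def opNorm (q : ℕ) (emb : S → (F →+* E)) (r : ℝ) (J : Set S) (d : S → ℕ)
    (μ : (F → E) →ₗ[E] E) : ℝ :=
  sSup {x | ∃ f : F → E, IsCrJ q emb r J d f ∧ crNorm q emb r f ≠ 0 ∧
    x = ‖μ f‖ / crNorm q emb r f}


theorem smul_mem_Lambda [IsUltrametricDist E] {emb : S → (F →+* E)} {J : Set S}
    {d : S → ℕ} {χ1 χ2 : F →* E} {c : E} (hc : ‖c‖ ≤ 1) {f : F → E} (hf : f ∈ Lambda emb J d χ1 χ2) :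
    c • f ∈ Lambda emb J d χ1 χ2 :=
  (Lambda emb J d χ1 χ2).smul_mem (⟨c, hc⟩ : unitBall E) hf

theorem smul_mem_Lambda_of_norm_le [IsUltrametricDist E] {emb : S → (F →+* E)} {J : Set S} {d : S → ℕ}
    {χ1 χ2 : F →* E} {a b : E} (hb : b ≠ 0) (hab : ‖a‖ ≤ ‖b‖) {f : F → E}
    (hf : b • f ∈ Lambda emb J d χ1 χ2) : a • f ∈ Lambda emb J d χ1 χ2 := by
  have h : a • f = (a / b) • (b • f) := by rw [smul_smul, div_mul_cancel₀ _ hb]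
  rw [h]
  refine smul_mem_Lambda ?_ hf
  rw [norm_div]
  exact div_le_one_of_le₀ hab (norm_nonneg b)

/-- Binomial expansion of `(x + y)^i` for multi-indices. -/
theorem mPow_add (emb : S → (F →+* E)) (x y : F) (i : S → ℕ) :
    mPow emb (x + y) i = ∑ j ∈ Fintype.piFinset fun σ => Finset.range (i σ + 1),
      (∏ σ, emb σ y ^ (i σ - j σ) * ((i σ).choose (j σ) : E)) * mPow emb x j := by
  simp only [mPow, map_add, add_pow, Finset.prod_univ_sum]
  refine Finset.sum_congr rfl fun j _ => ?_
  rw [← Finset.prod_mul_distrib]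
  exact Finset.prod_congr rfl fun σ _ => by ring

theorem mPow_div (emb : S → (F →+* E)) (x y : F) (i : S → ℕ) :
    mPow emb (x / y) i = mPow emb x i / mPow emb y i := by
  simp only [mPow, map_div₀, div_pow, Finset.prod_div_distrib]

theorem norm_mPow {emb : S → (F →+* E)} (hemb : ∀ (σ : S) (z : F), ‖emb σ z‖ = ‖z‖)
    (z : F) (i : S → ℕ) : ‖mPow emb z i‖ = ‖z‖ ^ mSum i := by
  simp only [mPow, mSum, norm_prod, norm_pow, hemb, Finset.prod_pow_eq_pow_sum]

theorem norm_dPow {emb : S → (F →+* E)} (hemb : ∀ (σ : S) (z : F), ‖emb σ z‖ = ‖z‖)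
    (J : Set S) (d : S → ℕ) (z : F) : ‖dPow emb J d z‖ = ‖z‖ ^ dSum J d := by
  simp only [dPow, dSum, norm_prod, norm_pow, hemb, Finset.prod_pow_eq_pow_sum]

/-- A translate of a polynomial generator, as a multiple of a `test1` function. -/
theorem smul_test1_mem_Lambda [IsUltrametricDist E] {q : ℕ} {emb : S → (F →+* E)}
    {J : Set S} {d : S → ℕ}
    {χ1 χ2 : F →* E} {t : F} (ht : t ≠ 0) (hχ1 : χ1 t ≠ 0) {n : ℤ}
    (htn : ‖t‖ = (q : ℝ) ^ (-n)) (a : F) {i : S → ℕ} (hi : ∀ σ, σ ∉ J → i σ ≤ d σ) :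
    (χ2 t * dPow emb J d t / mPow emb t i) • test1 q emb a n i ∈ Lambda emb J d χ1 χ2 := by
  refine Submodule.subset_span ⟨t, a, 1, i, ht, one_ne_zero, hi, Or.inl ?_⟩
  funext z
  have hball : ‖(z - a) / t‖ ≤ 1 ↔ ‖z - a‖ ≤ (q : ℝ) ^ (-n) := by
    rw [norm_div, div_le_one (norm_pos_iff.mpr ht), htn]
  simp only [Pi.smul_apply, smul_eq_mul, test1, borelAct, genPoly, one_mul, mul_one, hball,
    chRatio, mul_div_cancel₀ _ hχ1, mPow_div]
  split_ifs
  · ring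
  · simp

/-- Refining a disk into its subdisks of the next level. -/
theorem test1_eq_sum [IsUltrametricDist F] {q : ℕ} (hq : 1 ≤ q) (emb : S → (F →+* E))
    (a : F) (n : ℤ) (i : S → ℕ) {R : Finset F} (hR : ∀ x ∈ R, ‖x - a‖ ≤ (q : ℝ) ^ (-n))
    (hRu : ∀ z : F, ‖z - a‖ ≤ (q : ℝ) ^ (-n) →
      ∃! x, x ∈ R ∧ ‖z - x‖ ≤ (q : ℝ) ^ (-(n + 1))) :
    test1 q emb a n i = ∑ x ∈ R, ∑ j ∈ Fintype.piFinset fun σ => Finset.range (i σ + 1),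
      (∏ σ, emb σ (x - a) ^ (i σ - j σ) * ((i σ).choose (j σ) : E)) •
        test1 q emb x (n + 1) j := by
  have hle : (q : ℝ) ^ (-(n + 1)) ≤ (q : ℝ) ^ (-n) :=
    zpow_le_zpow_right₀ (by exact_mod_cast hq) (by lia)
  have key : ∀ z x : F, (∑ j ∈ Fintype.piFinset fun σ => Finset.range (i σ + 1),
      (∏ σ, emb σ (x - a) ^ (i σ - j σ) * ((i σ).choose (j σ) : E)) •
        test1 q emb x (n + 1) j z) =
      if ‖z - x‖ ≤ (q : ℝ) ^ (-(n + 1)) then mPow emb (z - a) i else 0 := by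
    intro z x
    unfold test1
    split_ifs
    · rw [← sub_add_sub_cancel z x a, mPow_add]
      simp only [smul_eq_mul]
    · simp
  funext z
  simp only [Finset.sum_apply, Pi.smul_apply, key]
  by_cases hz : ‖z - a‖ ≤ (q : ℝ) ^ (-n)
  · obtain ⟨x, ⟨hxR, hx⟩, hu⟩ := hRu z hz
    rw [Finset.sum_eq_single_of_mem x hxR, if_pos hx, test1, if_pos hz]
    intro y hy hyx
    exact if_neg fun h => hyx (hu y ⟨hy, h⟩)
  · rw [test1, if_neg hz, Finset.sum_eq_zero]
    intro x hx
    refine if_neg fun h => hz ?_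
    rw [← sub_add_sub_cancel z x a]
    exact (IsUltrametricDist.norm_add_le_max _ _).trans (max_le (h.trans hle) (hR x hx))

theorem norm_prod_pow_mul_choose_le_one [IsUltrametricDist E] {emb : S → (F →+* E)}
    (hemb : ∀ (σ : S) (z : F), ‖emb σ z‖ = ‖z‖) {y : F} (hy : ‖y‖ ≤ 1) (i j : S → ℕ) :
    ‖∏ σ, emb σ y ^ (i σ - j σ) * ((i σ).choose (j σ) : E)‖ ≤ 1 := by
  rw [norm_prod]
  refine Finset.prod_le_one (fun σ _ => norm_nonneg _) fun σ _ => ?_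
  rw [norm_mul, norm_pow, hemb]
  exact mul_le_one₀ (pow_le_one₀ (norm_nonneg y) hy) (norm_nonneg _)
    (IsUltrametricDist.norm_natCast_le_one E _)

/-- Proposition "nullita" (ii), proof: if v_p(χ2(p)) + |d| < 0, then for
every λ ∈ E, every n ∈ ℤ≥0 and every multi-index (k,m) (encoded by i with k ≤ d off J),
the function λ · 1_{D(0,n)}(z) z^k z^m belongs to Λ (so the completion of V(χ,J,d)
with respect to Λ vanishes). -/
theorem statement8
    {p q e f0 : ℕ} (hp : 1 < p) (hf0 : 0 < f0) (he : 0 < e) (hq : q = p ^ f0)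
    {F E : Type*} [NormedField F] [NormedField E]
    [IsUltrametricDist F] [IsUltrametricDist E]
    [CompleteSpace F] [CompleteSpace E]
    (ϖ : F) (hϖ : ‖ϖ‖ = (q : ℝ)⁻¹)
    (hval : ∀ x : F, x ≠ 0 → ∃ n : ℤ, ‖x‖ = (q : ℝ) ^ n)
    (hres : ∀ (a : F) (n : ℤ), ∃ R : Finset F, R.card = q ∧
      (∀ x ∈ R, ‖x - a‖ ≤ (q : ℝ) ^ (-n)) ∧
      ∀ z : F, ‖z - a‖ ≤ (q : ℝ) ^ (-n) → ∃! x, x ∈ R ∧ ‖z - x‖ ≤ (q : ℝ) ^ (-(n + 1)))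
    (hpF : ‖(p : F)‖ = (q : ℝ) ^ (-(e : ℤ)))
    (hpE : ‖(p : E)‖ = (p : ℝ) ^ (-((e * f0 : ℕ) : ℤ)))
    {S : Type*} [Fintype S] (emb : S → (F →+* E))
    (hemb : ∀ (σ : S) (z : F), ‖emb σ z‖ = ‖z‖)
    (J : Set S) (d : S → ℕ) (χ1 χ2 : F →* E)
    (hχ1 : IsLocJChar q emb J χ1) (hχ2 : IsLocJChar q emb J χ2)
    (hχ1ne : ∀ z : F, z ≠ 0 → χ1 z ≠ 0) (hχ2ne : ∀ z : F, z ≠ 0 → χ2 z ≠ 0)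
    (hneg : vP p (e * f0) (χ2 (p : F)) + (dSum J d : ℝ) < 0) :
    ∀ (lam : E) (n : ℕ) (i : S → ℕ), (∀ σ, σ ∉ J → i σ ≤ d σ) →
      lam • test1 q emb (0 : F) (n : ℤ) i ∈ Lambda emb J d χ1 χ2 := by
  intro lam n i hi
  have hq1 : 1 ≤ q := hq ▸ Nat.one_le_pow _ _ (by lia)
  have hqR : (1 : ℝ) ≤ q := by exact_mod_cast hq1
  have hp1 : (1 : ℝ) < p := by exact_mod_cast hp
  have hp0 : (p : F) ≠ 0 := by
    rw [← norm_pos_iff, hpF]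
    positivity
  have hpF1 : ‖(p : F)‖ ≤ 1 := by
    rw [hpF]
    exact zpow_le_one_of_nonpos₀ hqR (by lia)
  have hbase : 1 < ‖χ2 (p : F)‖ * ‖(p : F)‖ ^ dSum J d := by
    have hpos : 0 < ‖χ2 (p : F)‖ := norm_pos_iff.mpr (hχ2ne _ hp0)
    have hef : (0 : ℝ) < ((e * f0 : ℕ) : ℝ) := by exact_mod_cast Nat.mul_pos he hf0
    have hlog : ((e * f0 * dSum J d : ℕ) : ℝ) < Real.logb p ‖χ2 (p : F)‖ := by
      have h : (dSum J d : ℝ) < Real.logb p ‖χ2 (p : F)‖ / ((e * f0 : ℕ) : ℝ) := by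
        have := hneg
        rw [vP, neg_div] at this
        linarith
      rw [lt_div_iff₀ hef] at h
      rw [Nat.cast_mul]
      linarith
    rw [Real.lt_logb_iff_rpow_lt hp1 hpos, Real.rpow_natCast] at hlog
    have hnorm : ‖(p : F)‖ ^ dSum J d = ((p : ℝ) ^ (e * f0 * dSum J d))⁻¹ := by
      rw [hpF, hq, zpow_neg, zpow_natCast, inv_pow]
      push_cast
      rw [← pow_mul, ← pow_mul, mul_left_comm, mul_assoc]
    rw [hnorm, ← div_eq_mul_inv, one_lt_div (by positivity)]
    exact hlog
  obtain ⟨N₀, hN₀⟩ := pow_unbounded_of_one_lt ‖lam‖ hbase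
  set N := max N₀ n
  have hN : ‖lam‖ ≤ (‖χ2 (p : F)‖ * ‖(p : F)‖ ^ dSum J d) ^ N :=
    hN₀.le.trans (pow_le_pow_right₀ hbase.le (le_max_left _ _))
  have hnN : n ≤ e * N := (le_max_right N₀ n).trans (Nat.le_mul_of_pos_left _ he)
  have small : ∀ (a : F) (i : S → ℕ), (∀ σ, σ ∉ J → i σ ≤ d σ) →
      lam • test1 q emb a ((e * N : ℕ) : ℤ) i ∈ Lambda emb J d χ1 χ2 := by
    intro a i hi
    have ht : (p : F) ^ N ≠ 0 := pow_ne_zero _ hp0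
    have htn : ‖(p : F) ^ N‖ = (q : ℝ) ^ (-((e * N : ℕ) : ℤ)) := by
      rw [norm_pow, hpF, zpow_neg, zpow_neg, zpow_natCast, zpow_natCast, inv_pow, pow_mul]
    have hle : ‖lam‖ ≤ ‖χ2 ((p : F) ^ N) * dPow emb J d ((p : F) ^ N) /
        mPow emb ((p : F) ^ N) i‖ := by
      rw [norm_div, norm_mul, norm_dPow hemb, norm_mPow hemb, map_pow, norm_pow, norm_pow,
        pow_right_comm, ← mul_pow]
      refine hN.trans (le_div_self (by positivity) (by positivity) ?_)
      exact pow_le_one₀ (by positivity) (pow_le_one₀ (by positivity) hpF1)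
    refine smul_mem_Lambda_of_norm_le ?_ hle
      (smul_test1_mem_Lambda ht (hχ1ne _ ht) htn a hi)
    refine div_ne_zero (mul_ne_zero (hχ2ne _ ht) ?_) ?_
    · exact norm_pos_iff.mp (by rw [norm_dPow hemb]; positivity)
    · exact norm_pos_iff.mp (by rw [norm_mPow hemb]; positivity)
  have all : ∀ (a : F) (i : S → ℕ), (∀ σ, σ ∉ J → i σ ≤ d σ) →
      lam • test1 q emb a (n : ℤ) i ∈ Lambda emb J d χ1 χ2 := by
    induction hnN using Nat.decreasingInduction with
    | self => exact small
    | of_succ m _ ih =>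
      intro a i hi
      obtain ⟨R, -, hR, hRu⟩ := hres a m
      rw [test1_eq_sum hq1 emb a m i hR hRu, Finset.smul_sum]
      refine Submodule.sum_mem _ fun x hx => ?_
      rw [Finset.smul_sum]
      refine Submodule.sum_mem _ fun j hj => ?_
      rw [smul_comm]
      refine smul_mem_Lambda (norm_prod_pow_mul_choose_le_one hemb ?_ i j) ?_
      · exact (hR x hx).trans (zpow_le_one_of_nonpos₀ hqR (by lia))
      · refine ih x j fun σ hσ => le_trans ?_ (hi σ hσ)
        have := Fintype.mem_piFinset.mp hj σ
        exact Nat.lt_succ_iff.mp (Finset.mem_range.mp this)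
  exact all 0 i hi
end Paper
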